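/- Let Λ be a non-ordinary numerical semigroup whose minimal generators larger than its Frobenius number are λ_{i_1} < λ_{i_2} < ⋯ < λ_{i_k}. Then for each j with 1 ≤ j ≤ k, the number of minimal generators of the numerical semigroup Λ \ {λ_{i_j}} that are larger than the Frobenius number of Λ \ {λ_{i_j}} is at most k - j + 1. -/

import Mathlib

/-- A numerical semigroup: a subset of ℕ containing 0, closed under addition,
with finite complement in ℕ. -/
structure NumericalSemigroup where
  carrier : Set ℕ
  zero_mem : 0 ∈ carrier
  add_mem : ∀ a ∈ carrier, ∀ b ∈ carrier, a + b ∈ carrier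
  cofinite : carrierᶜ.Finite

/-- The genus: the number of gaps (elements of the complement). -/
noncomputable def NumericalSemigroup.genus (S : NumericalSemigroup) : ℕ := S.carrierᶜ.ncard

/-- The Frobenius number: the largest gap. -/
noncomputable def NumericalSemigroup.frobenius (S : NumericalSemigroup) : ℕ := sSup S.carrierᶜ

/-- A minimal generator: a nonzero element of the semigroup that is not the
sum of two nonzero elements of the semigroup. -/
def NumericalSemigroup.IsMinimalGenerator (S : NumericalSemigroup) (x : ℕ) : Prop :=
  x ∈ S.carrier ∧ x ≠ 0 ∧ ¬ ∃ a ∈ S.carrier, ∃ b ∈ S.carrier, a ≠ 0 ∧ b ≠ 0 ∧ a + b = x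

/-- An ordinary numerical semigroup: {0} ∪ {n : n ≥ c} for some c. -/
def NumericalSemigroup.IsOrdinary (S : NumericalSemigroup) : Prop :=
  ∃ c : ℕ, S.carrier = {0} ∪ {n : ℕ | c ≤ n}

namespace NumericalSemigroup

theorem le_frobenius_of_notMem (S : NumericalSemigroup) {n : ℕ} (hn : n ∉ S.carrier) :
    n ≤ S.frobenius :=
  le_csSup S.cofinite.bddAbove hn

theorem mem_of_frobenius_lt (S : NumericalSemigroup) {n : ℕ} (hn : S.frobenius < n) :
    n ∈ S.carrier := by
  by_contra h
  exact (S.le_frobenius_of_notMem h).not_gt hn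

/-- The multiplicity of a non-ordinary numerical semigroup lies below its Frobenius number. -/
theorem exists_multiplicity_lt_frobenius (S : NumericalSemigroup) (hord : ¬ S.IsOrdinary) :
    ∃ m ∈ S.carrier, m ≠ 0 ∧ m < S.frobenius ∧ ∀ b ∈ S.carrier, b ≠ 0 → m ≤ b := by
  classical
  have hex : ∃ n, n ∈ S.carrier ∧ n ≠ 0 :=
    ⟨S.frobenius + 1, S.mem_of_frobenius_lt (Nat.lt_succ_self _), Nat.succ_ne_zero _⟩
  obtain ⟨hm, hm0⟩ := Nat.find_spec hex
  have hmin : ∀ b ∈ S.carrier, b ≠ 0 → Nat.find hex ≤ b := fun b hb hb0 =>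
    Nat.find_min' hex ⟨hb, hb0⟩
  refine ⟨Nat.find hex, hm, hm0, ?_, hmin⟩
  by_contra hlt
  refine hord ⟨Nat.find hex, Set.ext fun n => ⟨fun hn => ?_, ?_⟩⟩
  · by_cases hn0 : n = 0
    · exact Or.inl hn0
    · exact Or.inr (hmin n hn hn0)
  · rintro (rfl | hn)
    · exact S.zero_mem
    · by_contra hgap
      have hle : Nat.find hex ≤ n := hn
      have hF := S.le_frobenius_of_notMem hgap
      have heq : n = Nat.find hex := by omega
      exact hgap (heq ▸ hm)

/-- If `T` is obtained from `S` by removing `l` above the Frobenius number, a minimal generator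
of `T` above `l` is either a minimal generator of `S` or the sum of `l` and the multiplicity. -/
theorem IsMinimalGenerator.of_diff_singleton {S T : NumericalSemigroup} {l m x : ℕ}
    (hl : S.frobenius < l) (hT : T.carrier = S.carrier \ {l})
    (hm : m ∈ S.carrier) (hm0 : m ≠ 0) (hmF : m < S.frobenius)
    (hmin : ∀ b ∈ S.carrier, b ≠ 0 → m ≤ b)
    (hx : T.IsMinimalGenerator x) :
    S.IsMinimalGenerator x ∨ x = l + m := by
  obtain ⟨hxT, hx0, hirr⟩ := hx
  have mem_T : ∀ n, n ∈ S.carrier → n ≠ l → n ∈ T.carrier := fun n h h' => by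
    rw [hT]; exact ⟨h, h'⟩
  have eq_of_add : ∀ b ∈ S.carrier, b ≠ 0 → l + b = x → x = l + m := by
    intro b hb hb0 hbx
    by_contra hne
    have hmb := hmin b hb hb0
    exact hirr ⟨m, mem_T m hm (by omega), l + b - m,
      mem_T _ (S.mem_of_frobenius_lt (by omega)) (by omega), hm0, by omega, by omega⟩
  rw [or_iff_not_imp_right]
  intro hne
  refine ⟨by rw [hT] at hxT; exact hxT.1, hx0, ?_⟩
  rintro ⟨a, ha, b, hb, ha0, hb0, hab⟩
  by_cases hal : a = l
  · exact hne (eq_of_add b hb hb0 (by omega))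
  by_cases hbl : b = l
  · exact hne (eq_of_add a ha ha0 (by omega))
  exact hirr ⟨a, mem_T a ha hal, b, mem_T b hb hbl, ha0, hb0, hab⟩

end NumericalSemigroup

/-- Let S be a non-ordinary numerical semigroup whose minimal generators larger
than its Frobenius number are f 0 < f 1 < ⋯ < f (k-1) (so f ⟨j-1⟩ is the j-th
such generator, 1 ≤ j ≤ k).  For each j, the number of minimal generators of
S \ {f ⟨j-1⟩} larger than its Frobenius number is at most k - j + 1. -/
theorem minimal_generators_upper_bound (S : NumericalSemigroup)
    (hord : ¬ S.IsOrdinary) (k : ℕ) (f : Fin k → ℕ) (hmono : StrictMono f)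
    (hrange : Set.range f = {x | S.IsMinimalGenerator x ∧ S.frobenius < x})
    (j : Fin k) (T : NumericalSemigroup) (hT : T.carrier = S.carrier \ {f j}) :
    {x | T.IsMinimalGenerator x ∧ T.frobenius < x}.ncard ≤ k - (j.val + 1) + 1 := by
  have hj : f j ∈ {x | S.IsMinimalGenerator x ∧ S.frobenius < x} := hrange ▸ Set.mem_range_self j
  obtain ⟨m, hm, hm0, hmF, hmin⟩ := S.exists_multiplicity_lt_frobenius hord
  have hsub : {x | T.IsMinimalGenerator x ∧ T.frobenius < x} ⊆
      (insert (f j + m) ((Finset.Ioi j).image f) : Finset ℕ) := by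
    rintro x ⟨hx, hxF⟩
    have hjx : f j < x := (T.le_frobenius_of_notMem (by simp [hT])).trans_lt hxF
    rw [Finset.mem_coe, Finset.mem_insert, Finset.mem_image]
    rcases hx.of_diff_singleton hj.2 hT hm hm0 hmF hmin with hxS | hxl
    · obtain ⟨i, rfl⟩ : x ∈ Set.range f := hrange ▸ ⟨hxS, hj.2.trans hjx⟩
      exact Or.inr ⟨i, Finset.mem_Ioi.2 (hmono.lt_iff_lt.1 hjx), rfl⟩
    · exact Or.inl hxl
  calc _ ≤ (insert (f j + m) ((Finset.Ioi j).image f) : Finset ℕ).card := by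
        rw [← Set.ncard_coe_finset]
        exact Set.ncard_le_ncard hsub (Finset.finite_toSet _)
    _ ≤ (Finset.Ioi j).card + 1 :=
        (Finset.card_insert_le _ _).trans (Nat.add_le_add_right Finset.card_image_le 1)
    _ = k - (j.val + 1) + 1 := by rw [Fin.card_Ioi]; omega
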